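/- arXiv:2604.02496 — 4 statements merged into one kernel-verified Lean document; each statement's English description precedes it below -/
import Mathlib

section
/- Let R = (v₁,…,v_ℓ) be a route, ξ ∈ [N] a scenario, and ȳ ∈ ℝ₊^{[N]×V₊}. There exist f^ξ ∈ ℝ₊^A and g^ξ ∈ ℝ₊^{V₊} satisfying f^ξ_{(v_{i−1},v_i)} + d^ξ(v_i) = f^ξ_{(v_i,v_{i+1})} + g^ξ_{v_i} for all i ∈ [ℓ], f^ξ_{(v_{i−1},v_i)} ≤ C for all i ∈ [ℓ+1], and g^ξ_{v_i} ≤ C·ȳ^ξ_{v_i} for all i ∈ [ℓ], if and only if ȳ^ξ(R') ≥ d^ξ(R')/C − 1 for every subroute R' ⊆ R. -/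
set_option autoImplicit false

open Finset

namespace VRPSD

variable {Vp : Type*} [Fintype Vp] [DecidableEq Vp]
variable {Sc : Type*} [Fintype Sc] [Nonempty Sc]

/-- Position `j` of the closed walk `0, v₁, …, v_ℓ, 0`:
`j = 0` gives the depot (`none`), `1 ≤ j ≤ ℓ` gives customer `v_j`,
and `j ≥ ℓ + 1` gives the depot again. -/
def nodeAt (L : List Vp) (j : ℕ) : Option Vp :=
  if j = 0 then none else L[j-1]?

/-- Directed flow feasibility (Formulation (1) of the paper) witnessing recourse action `y`
for the directed route given by the list `L = [v₁, …, v_ℓ]`, demand vector `d` and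
vehicle capacity `C`. -/
def FlowFeasible (C : ℚ) (d : Vp → ℚ) (L : List Vp) (y : Vp → ℝ) : Prop :=
  ∃ (f : Option Vp → Option Vp → ℝ) (g : Vp → ℝ),
    (∀ a b, 0 ≤ f a b) ∧ (∀ v, 0 ≤ g v) ∧
    (∀ j : Fin L.length,
      f (nodeAt L j.val) (nodeAt L (j.val + 1)) + (d (L.get j) : ℝ)
        = f (nodeAt L (j.val + 1)) (nodeAt L (j.val + 2)) + g (L.get j)) ∧
    (∀ j : Fin (L.length + 1), f (nodeAt L j.val) (nodeAt L (j.val + 1)) ≤ (C : ℝ)) ∧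
    (∀ j : Fin L.length, g (L.get j) ≤ (C : ℝ) * y (L.get j))

/-- `𝒴^ξ(→R)` : the set of recourse actions for the directed route `L` and a fixed scenario
with demand vector `d`: nonnegative integer vectors admitting a feasible flow. -/
def RecourseActions (C : ℚ) (d : Vp → ℚ) (L : List Vp) : Set (Vp → ℝ) :=
  {y | (∀ v, 0 ≤ y v) ∧ (∀ v, ∃ m : ℤ, y v = (m : ℝ)) ∧ FlowFeasible C d L y}

/-- `Π(R)` : the set of recourse policies for route `L`. -/
def Policies (C : ℚ) (d : Sc → Vp → ℚ) (L : List Vp) : Set (Sc → Vp → ℝ) :=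
  {y | ∀ ξ, y ξ ∈ RecourseActions C (d ξ) L}

/-- `[0,b]^N`. -/
def Box (b : Vp → ℤ) : Set (Sc → Vp → ℝ) :=
  {y | ∀ ξ v, 0 ≤ y ξ v ∧ y ξ v ≤ (b v : ℝ)}

/-- `x(δ(v))` for a customer `v`. -/
noncomputable def degCust (x : Option Vp → Option Vp → ℝ) (v : Vp) : ℝ :=
  ∑ u ∈ univ.filter (fun u => u ≠ some v), x u (some v)

/-- `x(δ(0))`. -/
noncomputable def degDepot (x : Option Vp → Option Vp → ℝ) : ℝ :=
  ∑ u ∈ univ.filter (fun u => u ≠ (none : Option Vp)), x u none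

/-- `x(E(S))` for a customer set `S`. -/
noncomputable def inSum (x : Option Vp → Option Vp → ℝ) (S : Finset Vp) : ℝ :=
  (1/2) * ∑ u ∈ S, ∑ v ∈ S.filter (fun v => v ≠ u), x (some u) (some v)

/-- The subtour-elimination polytope `𝒳_sub` (symmetric edge variables). -/
def Xsub : Set (Option Vp → Option Vp → ℝ) :=
  {x | (∀ u v, x u v = x v u) ∧ (∀ u, x u u = 0) ∧
       (∀ u v, u ≠ v → 0 ≤ x u v ∧ x u v ≤ 2) ∧
       (∀ v : Vp, degCust x v = 2) ∧
       (∀ S : Finset Vp, S.Nonempty → inSum x S ≤ (S.card : ℝ) - 1)}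

/-- `k_ξ(S) = ⌈d^ξ(S)/C⌉`. -/
def kxi (C : ℚ) (d : Vp → ℚ) (S : Finset Vp) : ℤ := ⌈(∑ v ∈ S, d v) / C⌉

/-- The CVRP-feasible polytope `𝒳_cvrp`. -/
def Xcvrp (C : ℚ) (p : Sc → ℚ) (d : Sc → Vp → ℚ) (k : ℕ) :
    Set (Option Vp → Option Vp → ℝ) :=
  Xsub ∩ {x | degDepot x = 2 * (k : ℝ) ∧
    ∀ S : Finset Vp, S.Nonempty →
      inSum x S ≤ (S.card : ℝ) - ((⌈(∑ v ∈ S, ∑ ξ, p ξ * d ξ v) / C⌉ : ℤ) : ℝ)}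

/-- A routing plan: a collection of routes whose customer sets partition `V₊`. -/
def IsRoutingPlan (Rs : List (List Vp)) : Prop :=
  (∀ L ∈ Rs, L ≠ [] ∧ L.Nodup) ∧
  ∀ v : Vp, ∃! i : Fin Rs.length, v ∈ Rs.get i

/-- The incidence vector of the edges of a single route `L` (closed walk through the depot). -/
noncomputable def routeInc (L : List Vp) (u u' : Option Vp) : ℝ :=
  ∑ j ∈ Finset.range (L.length + 1),
    (if (nodeAt L j = u ∧ nodeAt L (j+1) = u') ∨ (nodeAt L j = u' ∧ nodeAt L (j+1) = u)
     then (1 : ℝ) else 0)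

/-- The incidence vector `x̄` of a routing plan. -/
noncomputable def planInc (Rs : List (List Vp)) (u u' : Option Vp) : ℝ :=
  (Rs.map (fun L => routeInc L u u')).sum

/-- The set `FLOW(x̄)`. -/
def FLOW (C : ℚ) (d : Sc → Vp → ℚ) (b : Vp → ℤ) (x : Option Vp → Option Vp → ℝ) :
    Set (Sc → Vp → ℝ) :=
  {y | y ∈ Box b ∧
    ∃ (f : Sc → Option Vp → Option Vp → ℝ) (g : Sc → Vp → ℝ),
      (∀ ξ a c, 0 ≤ f ξ a c) ∧ (∀ ξ v, 0 ≤ g ξ v) ∧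
      (∀ ξ (v : Vp),
        (∑ u ∈ univ.filter (fun u => u ≠ some v), f ξ u (some v)) + (d ξ v : ℝ)
          = (∑ u ∈ univ.filter (fun u => u ≠ some v), f ξ (some v) u) + g ξ v) ∧
      (∀ ξ (u u' : Option Vp), u ≠ u' → f ξ u u' ≤ ((C : ℝ)/2) * x u u') ∧
      (∀ ξ v, g ξ v ≤ (C : ℝ) * y ξ v)}

/-- The set `SRI(x̄)` (on the `y`-variables only). -/
def SRIy (C : ℚ) (d : Sc → Vp → ℚ) (b : Vp → ℤ) (x : Option Vp → Option Vp → ℝ) :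
    Set (Sc → Vp → ℝ) :=
  {y | y ∈ Box b ∧ ∀ S : Finset Vp, S.Nonempty → ∀ ξ,
    ((kxi C (d ξ) S : ℝ) + inSum x S - (S.card : ℝ)) ≤ ∑ v ∈ S, y ξ v}

/-- The recourse cost `Σ_ξ Σ_v p_ξ w_v y^ξ_v`. -/
noncomputable def cost (p : Sc → ℚ) (w : Vp → ℚ) (y : Sc → Vp → ℝ) : ℝ :=
  ∑ ξ, ∑ v, (p ξ : ℝ) * (w v : ℝ) * y ξ v

/-- `ν(α,β)`. -/
noncomputable def nu (C : ℚ) (d : Sc → Vp → ℚ) (b : Vp → ℤ)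
    (α : Sc → Finset Vp → ℝ) (β : Sc → Vp → ℝ) : ℝ :=
  (∑ ξ, ∑ S ∈ univ.filter (fun S : Finset Vp => S ≠ ∅),
      α ξ S * ((kxi C (d ξ) S : ℝ) - (S.card : ℝ)))
  + ∑ ξ, ∑ v, β ξ v * (b v : ℝ)

/-- `φ_v(α,β)` (only meaningful for `v` with `w v > 0`). -/
noncomputable def phiv (p : Sc → ℚ) (w : Vp → ℚ)
    (α : Sc → Finset Vp → ℝ) (β : Sc → Vp → ℝ) (v : Vp) : ℝ :=
  max (Finset.univ.sup' Finset.univ_nonempty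
    (fun ξ => (β ξ v + ∑ S ∈ univ.filter (fun S : Finset Vp => v ∈ S), α ξ S)
      / ((p ξ : ℝ) * (w v : ℝ)))) 0

/-- The set `𝒜` of multipliers. -/
def multA (w : Vp → ℚ) (α : Sc → Finset Vp → ℝ) (β : Sc → Vp → ℝ) : Prop :=
  (∀ ξ (S : Finset Vp), S ≠ ∅ → 0 ≤ α ξ S) ∧ (∀ ξ v, β ξ v ≤ 0) ∧
  (∀ ξ v, w v = 0 →
    β ξ v + (∑ S ∈ univ.filter (fun S : Finset Vp => v ∈ S), α ξ S) ≤ 0)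

/-- The set `ŜRI(x̄)` of pairs `(θ, y)`. -/
def SRIhat (C : ℚ) (d : Sc → Vp → ℚ) (p : Sc → ℚ) (w : Vp → ℚ) (b : Vp → ℤ)
    (x : Option Vp → Option Vp → ℝ) : Set ((Vp → ℝ) × (Sc → Vp → ℝ)) :=
  {θy | (∀ v, 0 ≤ θy.1 v) ∧ θy.2 ∈ Box b ∧
    (∀ S : Finset Vp, S.Nonempty → ∀ ξ,
      ((kxi C (d ξ) S : ℝ) + inSum x S - (S.card : ℝ)) ≤ ∑ v ∈ S, θy.2 ξ v) ∧
    (∀ v, (∑ ξ, (p ξ : ℝ) * (w v : ℝ) * θy.2 ξ v) ≤ θy.1 v)}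

/-- The polyhedron `𝒫`. -/
def Pset (X : Set (Option Vp → Option Vp → ℝ)) (C : ℚ) (d : Sc → Vp → ℚ)
    (p : Sc → ℚ) (w : Vp → ℚ) (b : Vp → ℤ) :
    Set ((Option Vp → Option Vp → ℝ) × (Vp → ℝ)) :=
  {xθ | xθ.1 ∈ X ∧ ∃ y, (xθ.2, y) ∈ SRIhat C d p w b xθ.1}

/-- The set `Γ(x̄, α, β)`. -/
def GammaSet (C : ℚ) (d : Sc → Vp → ℚ) (p : Sc → ℚ) (w : Vp → ℚ) (b : Vp → ℤ)
    (x : Option Vp → Option Vp → ℝ) (α : Sc → Finset Vp → ℝ) (β : Sc → Vp → ℝ) :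
    Set ((Vp → ℝ) × (Sc → Vp → ℝ)) :=
  {θy | (∀ v, 0 ≤ θy.1 v) ∧ θy.2 ∈ Box b ∧
    ((∑ ξ, ∑ S ∈ univ.filter (fun S : Finset Vp => S ≠ ∅), α ξ S * inSum x S)
        + nu C d b α β
      ≤ ∑ ξ, ∑ v, (β ξ v + ∑ S ∈ univ.filter (fun S : Finset Vp => v ∈ S), α ξ S)
          * θy.2 ξ v) ∧
    (∀ v, (∑ ξ, (p ξ : ℝ) * (w v : ℝ) * θy.2 ξ v) ≤ θy.1 v)}

/-- `V₊(H)` for a partial route given as a list of customer sets. -/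
def VplusH (Hs : List (Finset Vp)) : Finset Vp := Hs.foldr (· ∪ ·) ∅

/-- `x(E(S,T))` for disjoint customer sets `S`, `T`. -/
noncomputable def crossSum (x : Option Vp → Option Vp → ℝ) (S T : Finset Vp) : ℝ :=
  ∑ u ∈ S, ∑ v ∈ T, x (some u) (some v)

/-- `x(H)` for a partial route `H`. -/
noncomputable def xH (x : Option Vp → Option Vp → ℝ) (Hs : List (Finset Vp)) : ℝ :=
  (Hs.map (fun S => inSum x S)).sum
    + (List.zipWith (fun S T => crossSum x S T) Hs Hs.tail).sum

/-- The activation function `W_OF(x ; H)`. -/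
noncomputable def WOF (x : Option Vp → Option Vp → ℝ) (Hs : List (Finset Vp)) : ℝ :=
  1 + (xH x Hs - ((VplusH Hs).card : ℝ) + 1)
    + ∑ i ∈ ({2, Hs.length - 1} : Finset ℕ) ∩ Finset.Icc 1 Hs.length,
        (inSum x (Hs.getD (i-1) ∅) - ((Hs.getD (i-1) ∅).card : ℝ) + 1)

/-- A partial route: pairwise disjoint nonempty customer sets,
no two consecutive non-singletons. -/
def IsPartialRoute (Hs : List (Finset Vp)) : Prop :=
  Hs ≠ [] ∧ (∀ S ∈ Hs, S.Nonempty) ∧ Hs.Pairwise Disjoint ∧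
  Hs.Chain' (fun S T => S.card = 1 ∨ T.card = 1)

/-- Indices `(i,j)`, `i ≤ j`, of the contiguous sub-tuples of a partial route. -/
def segIdx (Hs : List (Finset Vp)) : Finset (ℕ × ℕ) :=
  (Finset.range Hs.length ×ˢ Finset.range Hs.length).filter fun q => q.1 ≤ q.2

/-- The customer set `V₊(H')` of the contiguous sub-tuple `H' = (S_i, …, S_j)` (0-based). -/
def seg (Hs : List (Finset Vp)) (i j : ℕ) : Finset Vp :=
  VplusH ((Hs.drop i).take (j + 1 - i))

/-- `cᵀ x` for symmetric edge functions. -/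
noncomputable def dotE (c x : Option Vp → Option Vp → ℝ) : ℝ :=
  (1/2) * ∑ u : Option Vp, ∑ v ∈ univ.filter (fun v => v ≠ u), c u v * x u v

end VRPSD

namespace VRPSD

variable {Vp : Type*} [Fintype Vp] [DecidableEq Vp]
variable {Sc : Type*} [Fintype Sc] [Nonempty Sc]

theorem aux_foldl (w : Vp → ℝ) (P : List Vp) :
    P.foldl (fun x v => max 0 (x + w v)) (0:ℝ) = 0 ∨
      ∃ M : List Vp, M ≠ [] ∧ M <:+ P ∧
        P.foldl (fun x v => max 0 (x + w v)) (0:ℝ) = (M.map w).sum := by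
  induction P using List.reverseRecOn with
  | nil => left; rfl
  | append_singleton P v ih =>
    rw [List.foldl_append, List.foldl_cons, List.foldl_nil]
    rcases max_choice (0:ℝ) (P.foldl (fun x v => max 0 (x + w v)) (0:ℝ) + w v) with h | h
    · left; exact h
    · right
      rw [h]
      rcases ih with h0 | ⟨M, hM, ⟨s, hs⟩, hsum⟩
      · exact ⟨[v], by simp, ⟨P, rfl⟩, by rw [h0]; simp⟩
      · exact ⟨M ++ [v], by simp, ⟨s, by rw [← hs]; simp⟩, by rw [hsum]; simp⟩

theorem aux_tele (L : List Vp) (F : ℕ → ℝ) (dd yy : Vp → ℝ)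
    (h : ∀ j : Fin L.length, F j.val + dd (L.get j) ≤ F (j.val + 1) + yy (L.get j))
    (s M : List Vp) : ∀ t, s ++ M ++ t = L →
      F s.length + (M.map dd).sum ≤ F (s.length + M.length) + (M.map yy).sum := by
  induction M using List.reverseRecOn with
  | nil => intro t _; simp
  | append_singleton M v ih =>
    intro t ht
    have h1 := ih ([v] ++ t) (by rw [← ht]; simp)
    have hlt : s.length + M.length < L.length := by rw [← ht]; simp
    have h2 := h ⟨s.length + M.length, hlt⟩
    have hv : L.get ⟨s.length + M.length, hlt⟩ = v := by
      subst ht; simp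
    rw [hv] at h2
    simp only [List.map_append, List.sum_append, List.length_append, List.map_cons, List.map_nil,
      List.sum_cons, List.sum_nil, List.length_cons, List.length_nil, zero_add, add_zero] at *
    rw [← add_assoc s.length]
    linarith

theorem aux_sumw (c : ℝ) (dd y : Vp → ℝ) (M : List Vp) :
    (M.map (fun v => dd v - c * y v)).sum = (M.map dd).sum - c * (M.map y).sum := by
  induction M with
  | nil => simp
  | cons a M ih => simp only [List.map_cons, List.sum_cons, ih]; ring

theorem aux_cast (d : Vp → ℚ) (M : List Vp) :
    (((M.map d).sum : ℚ) : ℝ) = (M.map (fun v => (d v : ℝ))).sum := by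
  induction M with
  | nil => simp
  | cons a M ih => simp only [List.map_cons, List.sum_cons, ← ih]; push_cast; ring

theorem aux_node (L : List Vp) (j : ℕ) : nodeAt L (j + 1) = L[j]? := by
  simp [nodeAt]

/-- Lemma 2 of the paper: the directed flow formulation is feasible for
`ȳ^ξ` iff `ȳ^ξ(R') ≥ d^ξ(R')/C − 1` for every subroute `R' ⊆ R`. -/
theorem statement_1
    (C : ℚ) (hC : 0 < C) (d : Sc → Vp → ℚ)
    (hd : ∀ ξ v, 0 ≤ d ξ v) (hdC : ∀ ξ v, d ξ v ≤ C)
    (L : List Vp) (hL : L ≠ []) (hnd : L.Nodup)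
    (ξ : Sc) (ybar : Sc → Vp → ℝ) (hy : ∀ ζ v, 0 ≤ ybar ζ v) :
    FlowFeasible C (d ξ) L (ybar ξ) ↔
      ∀ L' : List Vp, L' ≠ [] → L' <:+: L →
        (((L'.map (d ξ)).sum : ℚ) : ℝ) / (C : ℝ) - 1 ≤ (L'.map (ybar ξ)).sum := by
  have hC' : (0:ℝ) < (C:ℝ) := by exact_mod_cast hC
  constructor
  · rintro ⟨f, g, hf, hg, hflow, hcap, hgy⟩ M hM ⟨s, t, hst⟩
    have key := aux_tele L (fun j => f (nodeAt L j) (nodeAt L (j + 1)))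
      (fun v => (d ξ v : ℝ)) (fun v => (C : ℝ) * ybar ξ v)
      (by
        intro j
        have h1 := hflow j
        have h2 := hgy j
        simp only [add_assoc] at *
        norm_num at *
        linarith) s M t hst
    have h0 := hf (nodeAt L s.length) (nodeAt L (s.length + 1))
    have h1 := hcap ⟨s.length + M.length, by rw [← hst]; simp⟩
    simp only [List.sum_map_mul_left] at key h1
    rw [aux_cast, sub_le_iff_le_add, div_le_iff₀ hC']
    linarith
  · intro H
    set w : Vp → ℝ := fun v => (d ξ v : ℝ) - (C : ℝ) * ybar ξ v with hw
    set F : ℕ → ℝ := fun n => (L.take n).foldl (fun x v => max 0 (x + w v)) (0:ℝ) with hF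
    have hF0 : ∀ n, 0 ≤ F n := by
      intro n
      simp only [hF]
      rcases List.eq_nil_or_concat (L.take n) with h | ⟨P, v, h⟩
      · rw [h]; simp
      · rw [h]; simp
    have hFs : ∀ j : Fin L.length, F (j.val + 1) = max 0 (F j.val + w (L.get j)) := by
      intro j
      simp only [hF]
      rw [List.take_succ_eq_append_getElem j.isLt, List.foldl_append]
      rfl
    have hFC : ∀ n, F n ≤ C := by
      intro n
      rcases aux_foldl w (L.take n) with h | ⟨M, hM, hsuf, hsum⟩
      · have : F n = 0 := h
        rw [this]; exact hC'.le
      · have h1 : F n = (M.map w).sum := hsum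
        have h2 := H M hM (hsuf.isInfix.trans (List.take_prefix n L).isInfix)
        rw [aux_cast, sub_le_iff_le_add, div_le_iff₀ hC'] at h2
        rw [h1, hw, aux_sumw]
        linarith
    have hidx : ∀ j : Fin L.length, L.idxOf (L.get j) = j.val := by
      intro j; exact hnd.idxOf_getElem j.val j.isLt
    let f : Option Vp → Option Vp → ℝ := fun _ b => b.elim (F L.length) (fun v => F (L.idxOf v))
    have hfj : ∀ (a : Option Vp) (j : ℕ), j ≤ L.length → f a (nodeAt L (j + 1)) = F j := by
      intro a j hj
      rw [aux_node]
      rcases hj.lt_or_eq with h | h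
      · rw [List.getElem?_eq_getElem h]
        exact congrArg F (hidx ⟨j, h⟩)
      · subst h; simp [f]
    refine ⟨f, fun v => min (F (L.idxOf v) + (d ξ v : ℝ)) ((C : ℝ) * ybar ξ v), ?_, ?_, ?_, ?_, ?_⟩
    · rintro a (_ | v)
      · exact hF0 _
      · exact hF0 _
    · intro v
      have : (0:ℝ) ≤ d ξ v := by exact_mod_cast hd ξ v
      exact le_min (add_nonneg (hF0 _) this) (mul_nonneg hC'.le (hy ξ v))
    · intro j
      rw [hfj (nodeAt L j.val) _ j.isLt.le, hfj (nodeAt L (j.val + 1)) (j.val + 1) j.isLt, hFs j]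
      simp only [hidx, hw]
      rcases le_total (F j.val + (d ξ (L.get j) : ℝ)) ((C : ℝ) * ybar ξ (L.get j)) with h | h
      · rw [min_eq_left h, max_eq_left (by linarith)]; ring
      · rw [min_eq_right h, max_eq_right (by linarith)]; ring
    · intro j
      rw [hfj (nodeAt L j.val) _ (Nat.lt_succ_iff.mp j.isLt)]
      exact hFC _
    · intro j
      exact min_le_right _ _

end VRPSD
end

section
/- For every route R and every vector b ∈ ℤ₊^{V₊}, conv(Π(R) ∩ [0,b]^N) = conv(Π(R)) ∩ [0,b]^N, where [0,b]^N denotes the set of vectors y ∈ ℝ^{[N]×V₊} with 0 ≤ y^ξ_v ≤ b_v for all ξ ∈ [N] and v ∈ V₊. -/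
set_option autoImplicit false

open Finset

set_option linter.unusedSectionVars false
namespace VRPSD

variable {Vp : Type*} [Fintype Vp] [DecidableEq Vp]
variable {Sc : Type*} [Fintype Sc] [Nonempty Sc]

/-- value of `y` at position `k` of the list. -/
noncomputable def ev (L : List Vp) (y : Vp → ℝ) (k : ℕ) : ℝ := (L[k]?).elim 0 y

/-- prefix sums. -/
noncomputable def pre (L : List Vp) (y : Vp → ℝ) (k : ℕ) : ℝ := ∑ i ∈ Finset.range k, ev L y i

lemma ev_lt (L : List Vp) (y : Vp → ℝ) (k : ℕ) (h : k < L.length) : ev L y k = y L[k] := by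
  simp [ev, h]

lemma pre_succ (L : List Vp) (y : Vp → ℝ) (k : ℕ) : pre L y (k+1) = pre L y k + ev L y k := by
  simp [pre, Finset.sum_range_succ]

lemma ev_comb (L : List Vp) (x y : Vp → ℝ) (a b : ℝ) (k : ℕ) :
    ev L (a • x + b • y) k = a * ev L x k + b * ev L y k := by
  unfold ev
  cases L[k]? <;> simp

lemma pre_comb (L : List Vp) (x y : Vp → ℝ) (a b : ℝ) (k : ℕ) :
    pre L (a • x + b • y) k = a * pre L x k + b * pre L y k := by
  unfold pre
  simp only [ev_comb, Finset.sum_add_distrib, Finset.mul_sum]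

lemma pre_int (L : List Vp) (y : Vp → ℝ) (hy : ∀ v, ∃ m : ℤ, y v = m) (k : ℕ) :
    ∃ m : ℤ, pre L y k = m := by
  induction k with
  | zero => exact ⟨0, by simp [pre]⟩
  | succ k ih =>
    obtain ⟨m, hm⟩ := ih
    have : ∃ n : ℤ, ev L y k = n := by
      unfold ev
      cases L[k]? with
      | none => exact ⟨0, by simp⟩
      | some v => exact hy v
    obtain ⟨n, hn⟩ := this
    exact ⟨m + n, by rw [pre_succ, hm, hn]; push_cast; ring⟩

lemma flow_nec (C : ℚ) (d : Vp → ℚ) (L : List Vp) (y : Vp → ℝ) (h : FlowFeasible C d L y)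
    (i j : ℕ) (hij : i ≤ j) (hj : j ≤ L.length) :
    (pre L (fun v => (d v : ℝ)) j - pre L (fun v => (d v : ℝ)) i)
      - C * (pre L y j - pre L y i) ≤ C := by
  obtain ⟨f, g, hf, hg, hcons, hcap, hgy⟩ := h
  have key : ∀ n, i + n ≤ L.length →
      (pre L (fun v => (d v : ℝ)) (i+n) - pre L (fun v => (d v : ℝ)) i)
      - C * (pre L y (i+n) - pre L y i) ≤
        f (nodeAt L (i+n)) (nodeAt L (i+n+1)) := by
    intro n
    induction n with
    | zero => intro _; simpa using hf _ _
    | succ n ih =>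
      intro hn
      have hlt : i + n < L.length := by omega
      have h1 := ih (by omega)
      have h2 := hcons ⟨i+n, hlt⟩
      have h3 := hgy ⟨i+n, hlt⟩
      rw [← Nat.add_assoc, pre_succ, pre_succ, ev_lt _ _ _ hlt, ev_lt _ _ _ hlt]
      simp only [List.get_eq_getElem] at h2 h3
      have : i + n + 1 + 1 = i + n + 2 := rfl
      rw [this]
      linarith
  obtain ⟨n, rfl⟩ := Nat.exists_eq_add_of_le hij
  exact (key n hj).trans (hcap ⟨i+n, by omega⟩)

/-- greedy flow. -/
noncomputable def gr (C : ℝ) (d y : ℕ → ℝ) : ℕ → ℝ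
  | 0 => 0
  | (k+1) => max 0 (gr C d y k + d k - C * y k)

lemma gr_nonneg (C : ℝ) (d y : ℕ → ℝ) (k : ℕ) : 0 ≤ gr C d y k := by
  cases k <;> simp [gr]

lemma flow_suff (C : ℚ) (hC : 0 < C) (d : Vp → ℚ) (hd : ∀ v, 0 ≤ d v) (L : List Vp)
    (hnd : L.Nodup) (y : Vp → ℝ) (hy : ∀ v, 0 ≤ y v)
    (h : ∀ i j : ℕ, i ≤ j → j ≤ L.length →
    (pre L (fun v => (d v : ℝ)) j - pre L (fun v => (d v : ℝ)) i)
      - C * (pre L y j - pre L y i) ≤ C) : FlowFeasible C d L y := by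
  have hC' : (0:ℝ) < C := by exact_mod_cast hC
  set F := gr C (ev L (fun v => (d v : ℝ))) (ev L y) with hF
  have hF0 : ∀ k, 0 ≤ F k := gr_nonneg _ _ _
  have hFs : ∀ k, F (k+1) = max 0 (F k + ev L (fun v => (d v : ℝ)) k - C * ev L y k) :=
    fun k => rfl
  have hFr : ∀ k, ∃ i ≤ k, F k = (pre L (fun v => (d v : ℝ)) k - pre L (fun v => (d v : ℝ)) i)
      - C * (pre L y k - pre L y i) := by
    intro k
    induction k with
    | zero => exact ⟨0, le_rfl, by simp [hF, gr]⟩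
    | succ k ih =>
      obtain ⟨i, hi, he⟩ := ih
      rcases le_total 0 (F k + ev L (fun v => (d v : ℝ)) k - C * ev L y k) with h0 | h0
      · refine ⟨i, by omega, ?_⟩
        rw [hFs, max_eq_right h0, he, pre_succ, pre_succ]; ring
      · refine ⟨k+1, le_rfl, ?_⟩
        rw [hFs, max_eq_left h0]; ring
  have hFC : ∀ k ≤ L.length, F k ≤ C := by
    intro k hk
    obtain ⟨i, hi, he⟩ := hFr k
    rw [he]; exact h i k hi hk
  have hd' : ∀ v, (0:ℝ) ≤ d v := fun v => by exact_mod_cast hd v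
  let f : Option Vp → Option Vp → ℝ := fun _ b => b.elim (F L.length) (fun v => F (L.idxOf v))
  have hfn : ∀ j ≤ L.length, ∀ a, f a (nodeAt L (j+1)) = F j := by
    intro j hj a
    rcases hj.lt_or_eq with hlt | rfl
    · simp [f, nodeAt, hlt, hnd.idxOf_getElem]
    · simp [f, nodeAt]
  have hstep : ∀ j (hj : j < L.length), F (j+1) = max 0 (F j + d L[j] - C * y L[j]) := by
    intro j hj
    rw [hFs, ev_lt _ _ _ hj, ev_lt _ _ _ hj]
  refine ⟨f, fun v => if v ∈ L then F (L.idxOf v) + d v - F (L.idxOf v + 1) else 0,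
    ?_, ?_, ?_, ?_, ?_⟩
  · intro a b
    cases b <;> simp [f, hF0]
  · intro v
    by_cases hv : v ∈ L
    · have hlt := List.idxOf_lt_length_of_mem hv
      have := hstep _ hlt
      rw [List.getElem_idxOf] at this
      simp only [hv, if_true]
      have h1 := hF0 (L.idxOf v)
      have h2 := hd' v
      have h3 := mul_nonneg hC'.le (hy v)
      have : F (L.idxOf v + 1) ≤ F (L.idxOf v) + d v := by
        rw [this]; apply max_le <;> linarith
      linarith
    · simp [hv]
  · rintro ⟨j, hj⟩
    have e1 := hfn j hj.le (nodeAt L j)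
    have e2 := hfn (j+1) hj (nodeAt L (j+1))
    simp only [List.get_eq_getElem, List.getElem_mem, if_true, hnd.idxOf_getElem]
    rw [e1, show j + 2 = j + 1 + 1 from rfl, e2]; ring
  · rintro ⟨j, hj⟩
    simp only
    rw [hfn j (by omega) (nodeAt L j)]
    exact hFC j (by omega)
  · rintro ⟨j, hj⟩
    simp only [List.get_eq_getElem, List.getElem_mem, if_true, hnd.idxOf_getElem]
    have := hstep j hj
    have := le_max_right 0 (F j + d L[j] - C * y L[j])
    linarith

/-- Interval constraints with integral right-hand side. -/
noncomputable def IntK (C : ℚ) (d : Vp → ℚ) (L : List Vp) (i j : ℕ) : ℤ :=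
  ⌈((pre L (fun v => (d v : ℝ)) j - pre L (fun v => (d v : ℝ)) i) - C) / C⌉

lemma intK_of (C : ℚ) (hC : 0 < C) (d : Vp → ℚ) (L : List Vp) (y : Vp → ℝ)
    (hy : ∀ v, ∃ m : ℤ, y v = m) (i j : ℕ)
    (h : (pre L (fun v => (d v : ℝ)) j - pre L (fun v => (d v : ℝ)) i)
      - C * (pre L y j - pre L y i) ≤ C) :
    (IntK C d L i j : ℝ) ≤ pre L y j - pre L y i := by
  have hC' : (0:ℝ) < C := by exact_mod_cast hC
  obtain ⟨m, hm⟩ := pre_int L y hy j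
  obtain ⟨n, hn⟩ := pre_int L y hy i
  rw [hm, hn] at h ⊢
  rw [← Int.cast_sub]
  norm_cast
  apply Int.ceil_le.2
  rw [div_le_iff₀ hC']
  push_cast
  linarith

lemma of_intK (C : ℚ) (hC : 0 < C) (d : Vp → ℚ) (L : List Vp) (y : Vp → ℝ) (i j : ℕ)
    (h : (IntK C d L i j : ℝ) ≤ pre L y j - pre L y i) :
    (pre L (fun v => (d v : ℝ)) j - pre L (fun v => (d v : ℝ)) i)
      - C * (pre L y j - pre L y i) ≤ C := by
  have hC' : (0:ℝ) < C := by exact_mod_cast hC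
  have h1 := (Int.le_ceil _).trans h
  rw [div_le_iff₀ hC'] at h1
  linarith

/-- Threshold rounding. -/
noncomputable def rnd (L : List Vp) (y : Vp → ℝ) (θ : ℝ) (v : Vp) : ℝ :=
  (⌊pre L y (L.idxOf v) + y v + θ⌋ : ℝ) - (⌊pre L y (L.idxOf v) + θ⌋ : ℝ)

lemma pre_rnd (L : List Vp) (hnd : L.Nodup) (y : Vp → ℝ) (θ : ℝ) (k : ℕ) (hk : k ≤ L.length) :
    pre L (rnd L y θ) k = (⌊pre L y k + θ⌋ : ℝ) - (⌊θ⌋ : ℝ) := by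
  induction k with
  | zero => simp [pre]
  | succ k ih =>
    have hk' : k < L.length := hk
    rw [pre_succ, pre_succ, ih hk'.le, ev_lt _ _ _ hk', ev_lt _ _ _ hk', rnd,
      hnd.idxOf_getElem]
    ring

lemma floor_ge (s t θ : ℝ) (K : ℤ) (h : (K : ℝ) ≤ t - s) :
    (K : ℝ) ≤ (⌊t + θ⌋ : ℝ) - (⌊s + θ⌋ : ℝ) := by
  have : K + ⌊s + θ⌋ ≤ ⌊t + θ⌋ := by
    rw [Int.le_floor]
    push_cast
    have := Int.floor_le (s + θ)
    linarith
  have : ((K + ⌊s + θ⌋ : ℤ) : ℝ) ≤ (⌊t + θ⌋ : ℝ) := by exact_mod_cast this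
  push_cast at this
  linarith

lemma floor_le' (s t θ : ℝ) (K : ℤ) (h : t - s ≤ (K : ℝ)) :
    (⌊t + θ⌋ : ℝ) - (⌊s + θ⌋ : ℝ) ≤ K := by
  have := floor_ge t s θ (-K) (by push_cast; linarith)
  push_cast at this
  linarith

open MeasureTheory in
lemma floor_integrable (s : ℝ) :
    Integrable (fun θ : ℝ => (⌊s + θ⌋ : ℝ)) (volume.restrict (Set.Ico (0:ℝ) 1)) := by
  have hm : Measurable (fun θ : ℝ => (⌊s + θ⌋ : ℝ)) := by fun_prop
  refine Measure.integrableOn_of_bounded (M := |s| + 2) (by simp) hm.aestronglyMeasurable ?_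
  refine (ae_restrict_iff' measurableSet_Ico).2 (Filter.Eventually.of_forall fun θ hθ => ?_)
  rw [Real.norm_eq_abs, abs_le]
  have h1 := Int.floor_le (s + θ)
  have h2 := Int.lt_floor_add_one (s + θ)
  have h3 := hθ.1
  have h4 := hθ.2
  have h5 := neg_abs_le s
  have h6 := le_abs_self s
  constructor <;> linarith

open MeasureTheory in
lemma floor_integral (s : ℝ) :
    ∫ θ in Set.Ico (0:ℝ) 1, (⌊s + θ⌋ : ℝ) = s := by
  have h : ∀ θ ∈ Set.Ico (0:ℝ) 1, (⌊s + θ⌋ : ℝ) =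
      (⌊s⌋ : ℝ) + (Set.Ico (1 - Int.fract s) 1).indicator (fun _ => (1:ℝ)) θ := by
    intro θ hθ
    have hs := Int.floor_add_fract s
    have f0 := Int.fract_nonneg s
    have f1 := Int.fract_lt_one s
    by_cases hc : 1 - Int.fract s ≤ θ
    · rw [Set.indicator_of_mem (Set.mem_Ico.2 ⟨hc, hθ.2⟩)]
      have : ⌊s + θ⌋ = ⌊s⌋ + 1 := by
        rw [Int.floor_eq_iff]; push_cast
        constructor <;> linarith [hθ.1, hθ.2]
      rw [this]; push_cast; ring
    · rw [Set.indicator_of_notMem (fun hh => hc hh.1)]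
      have : ⌊s + θ⌋ = ⌊s⌋ := by
        rw [Int.floor_eq_iff]
        push Not at hc
        constructor <;> linarith [hθ.1, hθ.2]
      rw [this]; ring
  rw [setIntegral_congr_fun measurableSet_Ico h]
  have f0 := Int.fract_nonneg s
  have f1 := Int.fract_lt_one s
  rw [integral_add (by simp) ((integrable_const _).indicator measurableSet_Ico),
    integral_indicator measurableSet_Ico,
    Measure.restrict_restrict measurableSet_Ico,
    Set.inter_eq_left.2 (Set.Ico_subset_Ico_left (by linarith))]
  simp [f0]

lemma box_int_finite (b : Vp → ℤ) :
    {y : Sc → Vp → ℝ | y ∈ Box b ∧ ∀ ξ v, ∃ m : ℤ, y ξ v = m}.Finite := by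
  have : (Set.univ.pi fun _ : Sc => Set.univ.pi fun v : Vp =>
      ((fun m : ℤ => (m:ℝ)) '' Set.Icc 0 (b v))).Finite :=
    Set.Finite.pi fun _ => Set.Finite.pi fun v => (Set.finite_Icc _ _).image _
  refine this.subset ?_
  rintro y ⟨hy, hi⟩ ξ - v -
  obtain ⟨m, hm⟩ := hi ξ v
  have := hy ξ v
  rw [hm] at this
  exact ⟨m, ⟨by exact_mod_cast this.1, by exact_mod_cast this.2⟩, hm.symm⟩

lemma conv_sub (C : ℚ) (hC : 0 < C) (d : Sc → Vp → ℚ) (L : List Vp) :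
    convexHull ℝ (Policies C d L) ⊆ {y | ∀ ξ, ∀ i j : ℕ, i ≤ j → j ≤ L.length →
      (IntK C (d ξ) L i j : ℝ) ≤ pre L (y ξ) j - pre L (y ξ) i} := by
  apply convexHull_min
  · intro y hy ξ i j hij hj
    obtain ⟨h0, h1, h2⟩ := hy ξ
    exact intK_of C hC _ L _ h1 i j (flow_nec C _ L _ h2 i j hij hj)
  · intro x hx y hy a b ha hb hab ξ i j hij hj
    have h1 := mul_le_mul_of_nonneg_left (hx ξ i j hij hj) ha
    have h2 := mul_le_mul_of_nonneg_left (hy ξ i j hij hj) hb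
    have e : (a • x + b • y) ξ = a • x ξ + b • y ξ := rfl
    rw [e, pre_comb, pre_comb]
    have : (IntK C (d ξ) L i j : ℝ) = a * IntK C (d ξ) L i j + b * IntK C (d ξ) L i j := by
      rw [← add_mul, hab, one_mul]
    linarith

/-- Corollary 1 of the paper: `conv(Π(R) ∩ [0,b]^N) = conv(Π(R)) ∩ [0,b]^N`. -/
theorem statement_3
    (C : ℚ) (hC : 0 < C) (d : Sc → Vp → ℚ)
    (hd : ∀ ξ v, 0 ≤ d ξ v) (hdC : ∀ ξ v, d ξ v ≤ C)
    (L : List Vp) (hL : L ≠ []) (hnd : L.Nodup)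
    (b : Vp → ℤ) (hb : ∀ v, 0 ≤ b v) :
    convexHull ℝ (Policies C d L ∩ Box b) = convexHull ℝ (Policies C d L) ∩ Box b := by
  apply Set.Subset.antisymm
  · refine Set.subset_inter (convexHull_mono Set.inter_subset_left) ?_
    refine convexHull_min Set.inter_subset_right ?_
    intro x hx y hy s t hs ht hst ξ v
    have e : (s • x + t • y) ξ v = s * x ξ v + t * y ξ v := rfl
    have h1 := mul_le_mul_of_nonneg_left (hx ξ v).2 hs
    have h2 := mul_le_mul_of_nonneg_left (hy ξ v).2 ht
    have h3 := mul_nonneg hs (hx ξ v).1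
    have h4 := mul_nonneg ht (hy ξ v).1
    have h5 : (b v : ℝ) = s * b v + t * b v := by rw [← add_mul, hst, one_mul]
    rw [e]
    constructor <;> linarith
  · rintro y ⟨hy, hbox⟩
    have hK := conv_sub C hC d L hy
    have hfin : (Policies C d L ∩ Box b).Finite :=
      (box_int_finite (Sc := Sc) b).subset fun z hz => ⟨hz.2, fun ξ v => (hz.1 ξ).2.1 v⟩
    let F : ℝ → Sc → Vp → ℝ := fun θ ξ v => rnd L (y ξ) θ v
    let μ := MeasureTheory.volume.restrict (Set.Ico (0:ℝ) 1)
    haveI : MeasureTheory.IsProbabilityMeasure μ := ⟨by simp [μ]⟩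
    have hmem : ∀ θ, F θ ∈ Policies C d L ∩ Box b := by
      intro θ
      have hB : F θ ∈ Box b := by
        intro ξ v
        constructor
        · have := floor_ge (pre L (y ξ) (L.idxOf v)) (pre L (y ξ) (L.idxOf v) + y ξ v) θ 0
            (by have := (hbox ξ v).1; push_cast; linarith)
          simpa [F, rnd] using this
        · exact floor_le' _ _ θ (b v) (by have := (hbox ξ v).2; linarith)
      refine ⟨fun ξ => ⟨fun v => (hB ξ v).1, fun v => ⟨⌊pre L (y ξ) (L.idxOf v) + y ξ v + θ⌋ -
        ⌊pre L (y ξ) (L.idxOf v) + θ⌋, by simp [F, rnd]⟩, ?_⟩, hB⟩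
      refine flow_suff C hC (d ξ) (hd ξ) L hnd _ (fun v => (hB ξ v).1) fun i j hij hj => ?_
      refine of_intK C hC _ L _ i j ?_
      have := floor_ge _ _ θ _ (hK ξ i j hij hj)
      have e1 := pre_rnd L hnd (y ξ) θ i (hij.trans hj)
      have e2 := pre_rnd L hnd (y ξ) θ j hj
      change _ ≤ pre L (rnd L (y ξ) θ) j - pre L (rnd L (y ξ) θ) i
      rw [e1, e2]
      linarith
    have hint1 : ∀ ξ v, MeasureTheory.Integrable (fun θ => F θ ξ v) μ := fun ξ v =>
      (floor_integrable _).sub (floor_integrable _)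
    have hint : MeasureTheory.Integrable F μ :=
      MeasureTheory.Integrable.of_eval fun ξ => MeasureTheory.Integrable.of_eval fun v => hint1 ξ v
    have hres := (convex_convexHull ℝ (Policies C d L ∩ Box b)).integral_mem
      (hfin.isClosed_convexHull ℝ) (μ := μ)
      (Filter.Eventually.of_forall fun θ => subset_convexHull ℝ _ (hmem θ)) hint
    have heq : ∫ θ, F θ ∂μ = y := by
      funext ξ v
      rw [MeasureTheory.eval_integral (fun ξ => hint.eval ξ),
        MeasureTheory.eval_integral (fun v => hint1 ξ v)]
      change ∫ θ, ((⌊pre L (y ξ) (L.idxOf v) + y ξ v + θ⌋ : ℝ) -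
        (⌊pre L (y ξ) (L.idxOf v) + θ⌋ : ℝ)) ∂μ = _
      rw [MeasureTheory.integral_sub (floor_integrable _) (floor_integrable _),
        floor_integral, floor_integral]
      ring
    rw [heq] at hres
    exact hres

end VRPSD
end

section
/- Fix b ∈ ℤ₊^{V₊}. For x̄ ∈ 𝒳 define FLOW(x̄) := {y ∈ [0,b]^N : there exist f ∈ ℝ₊^{[N]×A} and g ∈ ℝ₊^{[N]×V₊} such that for every v ∈ V₊ and ξ ∈ [N], f^ξ(δ⁻(v)) + d^ξ(v) = f^ξ(δ⁺(v)) + g^ξ_v; for every arc (u,v) ∈ A and ξ ∈ [N], f^ξ_{(u,v)} ≤ (C/2)·x̄_{{u,v}}; and for every v ∈ V₊ and ξ ∈ [N], g^ξ_v ≤ C·y^ξ_v}. Then for every x̄ ∈ 𝒳 ∩ ℤ^E, FLOW(x̄) ∩ ℤ^{[N]×V₊} = Π(x̄) ∩ [0,b]^N. -/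
set_option autoImplicit false

open Finset

namespace VRPSD

variable {Vp : Type*} [Fintype Vp] [DecidableEq Vp]
variable {Sc : Type*} [Fintype Sc] [Nonempty Sc]

lemma aux_succ (L : List Vp) (hL : L.Nodup) (j0 : Fin L.length) (j : ℕ) :
    nodeAt L (j+1) = some (L.get j0) ↔ j = j0.val := by
  unfold nodeAt
  simp only [Nat.add_eq_zero_iff, one_ne_zero, and_false, if_false, Nat.add_sub_cancel]
  constructor
  · intro h
    obtain ⟨hj, he⟩ := List.getElem?_eq_some_iff.1 h
    exact (hL.getElem_inj_iff).1 he
  · rintro rfl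
    simp

lemma aux_zero (L : List Vp) (v : Vp) : nodeAt L 0 ≠ some v := by
  simp [nodeAt]

lemma aux_mem (L : List Vp) (v : Vp) (j : ℕ) (h : nodeAt L j = some v) : v ∈ L := by
  unfold nodeAt at h
  split_ifs at h
  exact List.mem_of_getElem? h

lemma aux_sum1 (L : List Vp) (hL : L.Nodup) (j0 : Fin L.length) (e : ℕ → ℝ) :
    ∑ j ∈ Finset.range (L.length + 1),
      (if nodeAt L (j+1) = some (L.get j0) then e j else 0) = e j0.val := by
  simp only [aux_succ L hL j0]
  rw [Finset.sum_ite_eq' ]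
  rw [if_pos]
  simp only [Finset.mem_range]; omega

lemma aux_sum0 (L : List Vp) (hL : L.Nodup) (j0 : Fin L.length) (e : ℕ → ℝ) :
    ∑ j ∈ Finset.range (L.length + 1),
      (if nodeAt L j = some (L.get j0) then e j else 0) = e (j0.val + 1) := by
  rw [Finset.sum_range_succ', if_neg (aux_zero _ _), add_zero]
  simp only [aux_succ L hL j0]
  rw [Finset.sum_ite_eq']
  rw [if_pos]
  simp only [Finset.mem_range]; omega

/-- unique position of a customer -/
lemma aux_tot1 (Rs : List (List Vp)) (h : IsRoutingPlan Rs) (i0 : Fin Rs.length)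
    (j0 : Fin (Rs.get i0).length) (e : Fin Rs.length → ℕ → ℝ) :
    ∑ i, ∑ j ∈ Finset.range ((Rs.get i).length + 1),
      (if nodeAt (Rs.get i) (j+1) = some ((Rs.get i0).get j0) then e i j else 0)
      = e i0 j0.val := by
  rw [Finset.sum_eq_single i0]
  · exact aux_sum1 _ (h.1 _ (List.get_mem _ _)).2 _ _
  · intro i _ hi
    apply Finset.sum_eq_zero
    intro j _
    rw [if_neg]
    intro hh
    exact hi ((h.2 ((Rs.get i0).get j0)).unique (aux_mem _ _ _ hh) (List.get_mem _ _))
  · simp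

lemma aux_tot0 (Rs : List (List Vp)) (h : IsRoutingPlan Rs) (i0 : Fin Rs.length)
    (j0 : Fin (Rs.get i0).length) (e : Fin Rs.length → ℕ → ℝ) :
    ∑ i, ∑ j ∈ Finset.range ((Rs.get i).length + 1),
      (if nodeAt (Rs.get i) j = some ((Rs.get i0).get j0) then e i j else 0)
      = e i0 (j0.val + 1) := by
  rw [Finset.sum_eq_single i0]
  · exact aux_sum0 _ (h.1 _ (List.get_mem _ _)).2 _ _
  · intro i _ hi
    apply Finset.sum_eq_zero
    intro j _
    rw [if_neg]
    intro hh
    exact hi ((h.2 ((Rs.get i0).get j0)).unique (aux_mem _ _ _ hh) (List.get_mem _ _))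
  · simp

lemma planInc_eq (Rs : List (List Vp)) (u u' : Option Vp) :
    planInc Rs u u' = ∑ i : Fin Rs.length, ∑ j ∈ Finset.range ((Rs.get i).length + 1),
      (if (nodeAt (Rs.get i) j = u ∧ nodeAt (Rs.get i) (j+1) = u') ∨
        (nodeAt (Rs.get i) j = u' ∧ nodeAt (Rs.get i) (j+1) = u) then (1 : ℝ) else 0) := by
  unfold planInc routeInc
  rw [← Fin.sum_univ_fun_getElem]
  rfl

lemma planInc_eq' (Rs : List (List Vp)) (u u' : Option Vp) (hu : u ≠ u') :
    planInc Rs u u' = ∑ i : Fin Rs.length, ∑ j ∈ Finset.range ((Rs.get i).length + 1),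
      ((if nodeAt (Rs.get i) (j+1) = u' then (if nodeAt (Rs.get i) j = u then (1:ℝ) else 0) else 0)
      + (if nodeAt (Rs.get i) j = u' then
          (if nodeAt (Rs.get i) (j+1) = u then (1:ℝ) else 0) else 0)) := by
  rw [planInc_eq]
  refine Finset.sum_congr rfl fun i _ => Finset.sum_congr rfl fun j _ => ?_
  by_cases h1 : nodeAt (Rs.get i) j = u <;> by_cases h2 : nodeAt (Rs.get i) (j+1) = u' <;>
  by_cases h3 : nodeAt (Rs.get i) j = u' <;> by_cases h4 : nodeAt (Rs.get i) (j+1) = u <;>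
  simp only [h1, h2, h3, h4, hu, hu.symm, and_self, and_true, true_and, and_false, false_and,
    or_self, or_true, true_or, or_false, false_or, if_true, if_false, add_zero, zero_add] <;>
  first | done | (exfalso; exact hu (h1.symm.trans h3)) | (exfalso; exact hu (h4.symm.trans h2))

lemma planInc_symm (Rs : List (List Vp)) (u u' : Option Vp) :
    planInc Rs u u' = planInc Rs u' u := by
  rw [planInc_eq, planInc_eq]
  refine Finset.sum_congr rfl fun i _ => Finset.sum_congr rfl fun j _ => ?_
  simp only [or_comm]

lemma planInc_nonneg (Rs : List (List Vp)) (u u' : Option Vp) : 0 ≤ planInc Rs u u' := by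
  rw [planInc_eq]
  refine Finset.sum_nonneg fun i _ => Finset.sum_nonneg fun j _ => ?_
  split_ifs <;> norm_num

lemma nodeAt_ne (L : List Vp) (hL : L.Nodup) (j0 : Fin L.length) :
    nodeAt L j0.val ≠ some (L.get j0) ∧ nodeAt L (j0.val + 2) ≠ some (L.get j0) := by
  constructor
  · rcases h : j0.val with _ | k
    · exact aux_zero _ _
    · rw [Ne, aux_succ L hL]; omega
  · rw [Ne, aux_succ L hL]; omega

lemma aux_filter (v : Vp) (w : Option Vp) (φ : Option Vp → ℝ) :
    ∑ u ∈ univ.filter (fun u => u ≠ some v), (if w = u then φ u else 0)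
      = if w ≠ some v then φ w else 0 := by
  rw [Finset.sum_ite_eq]
  simp only [Finset.mem_filter, Finset.mem_univ, true_and]

/-- sum over a star of the plan -/
lemma star_sum (Rs : List (List Vp)) (h : IsRoutingPlan Rs) (i0 : Fin Rs.length)
    (j0 : Fin (Rs.get i0).length) (φ : Option Vp → ℝ) :
    ∑ u ∈ univ.filter (fun u => u ≠ some ((Rs.get i0).get j0)),
      planInc Rs u (some ((Rs.get i0).get j0)) * φ u
      = φ (nodeAt (Rs.get i0) j0.val) + φ (nodeAt (Rs.get i0) (j0.val + 2)) := by
  have hn := nodeAt_ne (Rs.get i0) (h.1 _ (List.get_mem _ _)).2 j0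
  set v := (Rs.get i0).get j0 with hv
  have h1 := aux_tot1 Rs h i0 j0 (fun i j => if nodeAt (Rs.get i) j ≠ some v then
    φ (nodeAt (Rs.get i) j) else 0)
  have h0 := aux_tot0 Rs h i0 j0 (fun i j => if nodeAt (Rs.get i) (j+1) ≠ some v then
    φ (nodeAt (Rs.get i) (j+1)) else 0)
  rw [if_pos hn.1] at h1
  rw [if_pos hn.2] at h0
  rw [← h1, ← h0]
  rw [Finset.sum_congr rfl (g := fun u => ∑ i : Fin Rs.length,
    ∑ j ∈ Finset.range ((Rs.get i).length + 1),
      ((if nodeAt (Rs.get i) (j+1) = some v then (if nodeAt (Rs.get i) j = u then φ u else 0) else 0)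
      + (if nodeAt (Rs.get i) j = some v then
          (if nodeAt (Rs.get i) (j+1) = u then φ u else 0) else 0)))]
  · rw [Finset.sum_comm, ← Finset.sum_add_distrib]
    refine Finset.sum_congr rfl fun i _ => ?_
    rw [Finset.sum_comm, ← Finset.sum_add_distrib]
    refine Finset.sum_congr rfl fun j _ => ?_
    rw [Finset.sum_add_distrib]
    congr 1
    · by_cases ha : nodeAt (Rs.get i) (j+1) = some v
      · simp only [if_pos ha]
        rw [if_pos (ha.trans (congrArg some hv))]
        exact aux_filter v _ φ
      · simp only [if_neg ha, Finset.sum_const_zero]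
        rw [if_neg (fun h' => ha (h'.trans (congrArg some hv.symm)))]
    · by_cases ha : nodeAt (Rs.get i) j = some v
      · simp only [if_pos ha]
        rw [if_pos (ha.trans (congrArg some hv))]
        exact aux_filter v _ φ
      · simp only [if_neg ha, Finset.sum_const_zero]
        rw [if_neg (fun h' => ha (h'.trans (congrArg some hv.symm)))]
  · intro u hu
    rw [planInc_eq' _ _ _ (Finset.mem_filter.1 hu).2, Finset.sum_mul]
    refine Finset.sum_congr rfl fun i _ => ?_
    rw [Finset.sum_mul]
    refine Finset.sum_congr rfl fun j _ => ?_
    rw [add_mul]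
    simp only [ite_mul, one_mul, zero_mul]

/-- net flow -/
noncomputable def netT (Rs : List (List Vp)) (t : Fin Rs.length → ℕ → ℝ) (u u' : Option Vp) : ℝ :=
  ∑ i : Fin Rs.length, ∑ j ∈ Finset.range ((Rs.get i).length + 1),
    ((if nodeAt (Rs.get i) (j+1) = u' then (if nodeAt (Rs.get i) j = u then t i j else 0) else 0)
    - (if nodeAt (Rs.get i) j = u' then
          (if nodeAt (Rs.get i) (j+1) = u then t i j else 0) else 0))

lemma netT_anti (Rs : List (List Vp)) (t : Fin Rs.length → ℕ → ℝ) (u u' : Option Vp) :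
    netT Rs t u u' = - netT Rs t u' u := by
  unfold netT
  rw [← Finset.sum_neg_distrib]
  refine Finset.sum_congr rfl fun i _ => ?_
  rw [← Finset.sum_neg_distrib]
  refine Finset.sum_congr rfl fun j _ => ?_
  split_ifs <;> ring

lemma netT_le (Rs : List (List Vp)) (t : Fin Rs.length → ℕ → ℝ) (u u' : Option Vp) (hu : u ≠ u')
    (c : ℝ) (ht : ∀ i, ∀ j < (Rs.get i).length + 1, |t i j| ≤ c) :
    netT Rs t u u' ≤ c * planInc Rs u u' := by
  rw [planInc_eq' _ _ _ hu, netT, Finset.mul_sum]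
  refine Finset.sum_le_sum fun i _ => ?_
  rw [Finset.mul_sum]
  refine Finset.sum_le_sum fun j hj => ?_
  have := abs_le.1 (ht i j (Finset.mem_range.1 hj))
  split_ifs <;> linarith [this.1, this.2]

lemma netT_sum (Rs : List (List Vp)) (h : IsRoutingPlan Rs) (t : Fin Rs.length → ℕ → ℝ)
    (i0 : Fin Rs.length) (j0 : Fin (Rs.get i0).length) :
    ∑ u, netT Rs t u (some ((Rs.get i0).get j0)) = t i0 j0.val - t i0 (j0.val + 1) := by
  rw [← aux_tot1 Rs h i0 j0 t, ← aux_tot0 Rs h i0 j0 t]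
  unfold netT
  rw [Finset.sum_comm, ← Finset.sum_sub_distrib]
  refine Finset.sum_congr rfl fun i _ => ?_
  rw [Finset.sum_comm, ← Finset.sum_sub_distrib]
  refine Finset.sum_congr rfl fun j _ => ?_
  rw [Finset.sum_sub_distrib]
  congr 1 <;> split_ifs <;> simp

/-- Lemma 4 of the paper: for every integer routing plan `x̄ ∈ 𝒳 ∩ ℤ^E`,
`FLOW(x̄) ∩ ℤ^{[N]×V₊} = Π(x̄) ∩ [0,b]^N`. -/
theorem statement_5
    (C : ℚ) (hC : 0 < C) (d : Sc → Vp → ℚ)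
    (hd : ∀ ξ v, 0 ≤ d ξ v) (hdC : ∀ ξ v, d ξ v ≤ C)
    (p : Sc → ℚ) (hp : ∀ ξ, 0 ≤ p ξ) (hps : ∑ ξ, p ξ = 1)
    (k : ℕ) (hk : 0 < k)
    (X : Set (Option Vp → Option Vp → ℝ)) (hX : X = Xsub ∨ X = Xcvrp C p d k)
    (b : Vp → ℤ) (hb : ∀ v, 0 ≤ b v)
    (Rs : List (List Vp)) (hplan : IsRoutingPlan Rs)
    (hmem : planInc Rs ∈ X) :
    FLOW C d b (planInc Rs) ∩ {y : Sc → Vp → ℝ | ∀ ξ v, ∃ m : ℤ, y ξ v = (m : ℝ)}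
      = (⋂ i : Fin Rs.length, Policies C d (Rs.get i)) ∩ Box b := by
  have hC' : (0:ℝ) < (C:ℝ) := by exact_mod_cast hC
  ext y
  constructor
  · rintro ⟨⟨hbox, f, g, hf, hg, hcons, hcap, hgy⟩, hint⟩
    refine ⟨?_, hbox⟩
    rw [Set.mem_iInter]
    intro i ξ
    refine ⟨fun v => (hbox ξ v).1, hint ξ, ?_⟩
    have hb1 : ∀ a c, |(f ξ a c - f ξ c a) / planInc Rs a c| ≤ (C:ℝ)/2 := by
      intro a c
      by_cases hac : a = c
      · subst hac; simp; positivity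
      rcases (planInc_nonneg Rs a c).eq_or_lt with h0 | h0
      · rw [← h0]; simp; positivity
      · rw [abs_div, abs_of_pos h0, div_le_iff₀ h0, abs_le]
        have h1 := hcap ξ a c hac
        have h2 := hcap ξ c a (Ne.symm hac)
        rw [planInc_symm Rs c a] at h2
        constructor <;> linarith [hf ξ a c, hf ξ c a]
    refine ⟨fun a c => (f ξ a c - f ξ c a) / planInc Rs a c + (C:ℝ)/2, g ξ, ?_, hg ξ, ?_, ?_, ?_⟩
    · intro a c
      linarith [(abs_le.1 (hb1 a c)).1]
    · intro j
      have hs := star_sum Rs hplan i j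
        (fun u => (f ξ u (some ((Rs.get i).get j)) - f ξ (some ((Rs.get i).get j)) u)
          / planInc Rs u (some ((Rs.get i).get j)))
      have hc := hcons ξ ((Rs.get i).get j)
      have hnode : nodeAt (Rs.get i) (j.val + 1) = some ((Rs.get i).get j) :=
        (aux_succ _ (hplan.1 _ (List.get_mem _ _)).2 j j.val).2 rfl
      have he : ∑ u ∈ univ.filter (fun u => u ≠ some ((Rs.get i).get j)),
          planInc Rs u (some ((Rs.get i).get j)) *
          ((f ξ u (some ((Rs.get i).get j)) - f ξ (some ((Rs.get i).get j)) u)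
          / planInc Rs u (some ((Rs.get i).get j)))
          = ∑ u ∈ univ.filter (fun u => u ≠ some ((Rs.get i).get j)),
          (f ξ u (some ((Rs.get i).get j)) - f ξ (some ((Rs.get i).get j)) u) := by
        refine Finset.sum_congr rfl fun u hu => ?_
        have hu' := (Finset.mem_filter.1 hu).2
        by_cases h0 : planInc Rs u (some ((Rs.get i).get j)) = 0
        · have h1 := hcap ξ _ _ hu'
          have h2 := hcap ξ _ _ (Ne.symm hu')
          rw [planInc_symm Rs _ u] at h2
          rw [h0] at h1 h2 ⊢
          linarith [hf ξ u (some ((Rs.get i).get j)), hf ξ (some ((Rs.get i).get j)) u]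
        · field_simp
      rw [he, Finset.sum_sub_distrib] at hs
      simp only [hnode]
      have hsym : (f ξ (some ((Rs.get i).get j)) (nodeAt (Rs.get i) (j.val+2)) -
          f ξ (nodeAt (Rs.get i) (j.val+2)) (some ((Rs.get i).get j))) /
          planInc Rs (some ((Rs.get i).get j)) (nodeAt (Rs.get i) (j.val+2)) =
          - ((f ξ (nodeAt (Rs.get i) (j.val+2)) (some ((Rs.get i).get j)) -
          f ξ (some ((Rs.get i).get j)) (nodeAt (Rs.get i) (j.val+2))) /
          planInc Rs (nodeAt (Rs.get i) (j.val+2)) (some ((Rs.get i).get j))) := by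
        rw [planInc_symm Rs (some _) _]; ring
      rw [hsym]
      linarith
    · intro j
      linarith [(abs_le.1 (hb1 (nodeAt (Rs.get i) j.val) (nodeAt (Rs.get i) (j.val+1)))).2]
    · intro j
      exact hgy ξ _
  · rintro ⟨hpol, hbox⟩
    rw [Set.mem_iInter] at hpol
    have hpos : ∀ v : Vp, ∃ (i : Fin Rs.length) (j : Fin (Rs.get i).length),
        (Rs.get i).get j = v := by
      intro v
      obtain ⟨i, hi, -⟩ := hplan.2 v
      obtain ⟨j, hj⟩ := List.mem_iff_get.1 hi
      exact ⟨i, j, hj⟩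
    choose iv jv hv using hpos
    refine ⟨⟨hbox, ?_⟩, fun ξ v => (hpol (iv v) ξ).2.1 v⟩
    choose F G hF hG hcons hcap hgy using fun i ξ => (hpol i ξ).2.2
    refine ⟨fun ξ a c => max (netT Rs (fun i j => F i ξ (nodeAt (Rs.get i) j)
        (nodeAt (Rs.get i) (j+1)) - (C:ℝ)/2) a c) 0, fun ξ v => G (iv v) ξ v,
      fun _ _ _ => le_max_right _ _, fun ξ v => hG _ ξ v, ?_, ?_, ?_⟩
    · intro ξ v
      have hs := netT_sum Rs hplan (fun i j => F i ξ (nodeAt (Rs.get i) j)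
        (nodeAt (Rs.get i) (j+1)) - (C:ℝ)/2) (iv v) (jv v)
      have hc := hcons (iv v) ξ (jv v)
      rw [hv] at hs hc
      set T := netT Rs (fun i j => F i ξ (nodeAt (Rs.get i) j)
        (nodeAt (Rs.get i) (j+1)) - (C:ℝ)/2) with hT
      have hanti : ∀ a c, T a c = - T c a := fun a c => netT_anti _ _ _ _
      have hvv : T (some v) (some v) = 0 := by linarith [hanti (some v) (some v)]
      have h2 : ∑ u ∈ univ.filter (fun u => u ≠ some v), T u (some v) = ∑ u, T u (some v) := by
        rw [Finset.sum_filter]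
        refine Finset.sum_congr rfl fun u _ => ?_
        by_cases hu : u = some v
        · simp [hu, hvv]
        · simp [hu]
      have h3 : ∑ u ∈ univ.filter (fun u => u ≠ some v), T u (some v)
          = ∑ u ∈ univ.filter (fun u => u ≠ some v), max (T u (some v)) 0
            - ∑ u ∈ univ.filter (fun u => u ≠ some v), max (T (some v) u) 0 := by
        rw [← Finset.sum_sub_distrib]
        refine Finset.sum_congr rfl fun u _ => ?_
        rw [hanti (some v) u]
        rcases le_total 0 (T u (some v)) with h | h
        · rw [max_eq_left h, max_eq_right (by linarith)]; ring
        · rw [max_eq_right h, max_eq_left (by linarith)]; ring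
      linarith
    · intro ξ a c hac
      apply max_le
      · apply netT_le _ _ _ _ hac
        intro i j hj
        have h1 := hF i ξ (nodeAt (Rs.get i) j) (nodeAt (Rs.get i) (j+1))
        have h2 := hcap i ξ ⟨j, hj⟩
        simp only at h2
        rw [abs_le]
        constructor <;> linarith
      · exact mul_nonneg (by positivity) (planInc_nonneg _ _ _)
    · intro ξ v
      have := hgy (iv v) ξ (jv v)
      rwa [hv] at this

end VRPSD
end

section
/- Fix b ∈ ℤ₊^{V₊}. For every x̄ ∈ 𝒳, FLOW(x̄) = {y ∈ [0,b]^N : y^ξ(S) ≥ d^ξ(S)/C + x̄(E(S)) − |S| for every nonempty S ⊆ V₊ and every ξ ∈ [N]}, where y^ξ(S) := Σ_{v∈S} y^ξ_v. -/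
set_option autoImplicit false

open Finset

namespace VRPSD

variable {Vp : Type*} [Fintype Vp] [DecidableEq Vp]
variable {Sc : Type*} [Fintype Sc] [Nonempty Sc]

lemma gale {V : Type*} [Fintype V] [DecidableEq V] (c : V → V → ℝ) (s d : V → ℝ)
    (hc : ∀ u v, 0 ≤ c u v) (hs : ∀ v, 0 ≤ s v) (hd : ∀ v, 0 ≤ d v)
    (hcut : ∀ S : Finset V, ∑ v ∈ S, d v ≤ (∑ u ∈ S, ∑ v ∈ Sᶜ, c u v) + ∑ v ∈ S, s v) :
    ∃ (f : V → V → ℝ) (h : V → ℝ), (∀ u v, 0 ≤ f u v ∧ f u v ≤ c u v) ∧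
      (∀ v, 0 ≤ h v ∧ h v ≤ s v) ∧ ∀ v, (∑ u, f u v) + d v = (∑ u, f v u) + h v := by
  let e : (V → V → ℝ) × (V → ℝ) → V → ℝ :=
    fun z v => (∑ u, z.1 u v) + d v - (∑ u, z.1 v u) - z.2 v
  have hcomp : IsCompact (Set.Icc (0 : (V → V → ℝ) × (V → ℝ)) (c, s)) := isCompact_Icc
  have hcont : Continuous (fun z => ∑ v, e z v ^ 2) := by
    simp only [e]; fun_prop
  obtain ⟨⟨f, h⟩, hz, hmin⟩ := hcomp.exists_isMinOn
    ⟨0, by exact ⟨le_refl _, hc, hs⟩⟩ hcont.continuousOn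
  have hf0 : ∀ u v, 0 ≤ f u v := fun u v => hz.1.1 u v
  have hf1 : ∀ u v, f u v ≤ c u v := fun u v => hz.2.1 u v
  have hh0 : ∀ v, 0 ≤ h v := fun v => hz.1.2 v
  have hh1 : ∀ v, h v ≤ s v := fun v => hz.2.2 v
  set E : V → ℝ := e (f, h) with hE
  let f' : V → V → ℝ := fun u v => if E v < E u then c u v else if E u < E v then 0 else f u v
  let h' : V → ℝ := fun v => if 0 < E v then s v else if E v < 0 then 0 else h v
  have hf' : ∀ u v, 0 ≤ f' u v ∧ f' u v ≤ c u v := by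
    intro u v; simp only [f']; split_ifs
    · exact ⟨hc _ _, le_rfl⟩
    · exact ⟨le_rfl, hc _ _⟩
    · exact ⟨hf0 _ _, hf1 _ _⟩
  have hh' : ∀ v, 0 ≤ h' v ∧ h' v ≤ s v := by
    intro v; simp only [h']; split_ifs
    · exact ⟨hs _, le_rfl⟩
    · exact ⟨le_rfl, hs _⟩
    · exact ⟨hh0 _, hh1 _⟩
  let D : V → ℝ := fun v => (∑ u, (f' u v - f u v)) - (∑ u, (f' v u - f v u)) - (h' v - h v)
  have hvar : ∀ t : ℝ, 0 ≤ t → t ≤ 1 →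
      0 ≤ 2 * t * (∑ v, E v * D v) + t ^ 2 * ∑ v, D v ^ 2 := by
    intro t ht0 ht1
    have hmem : ((fun u v => f u v + t * (f' u v - f u v), fun v => h v + t * (h' v - h v)) :
        (V → V → ℝ) × (V → ℝ)) ∈ Set.Icc (0 : (V → V → ℝ) × (V → ℝ)) (c, s) := by
      refine ⟨⟨fun u v => ?_, fun v => ?_⟩, ⟨fun u v => ?_, fun v => ?_⟩⟩
      · show 0 ≤ f u v + t * (f' u v - f u v)
        nlinarith [hf0 u v, (hf' u v).1]
      · show 0 ≤ h v + t * (h' v - h v)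
        nlinarith [hh0 v, (hh' v).1]
      · show f u v + t * (f' u v - f u v) ≤ c u v
        nlinarith [hf1 u v, (hf' u v).2]
      · show h v + t * (h' v - h v) ≤ s v
        nlinarith [hh1 v, (hh' v).2]
    have h1 := hmin hmem
    simp only [Set.mem_setOf_eq] at h1
    have h2 : ∀ v, e (fun u v => f u v + t * (f' u v - f u v), fun v => h v + t * (h' v - h v)) v
        = E v + t * D v := by
      intro v
      simp only [hE, e, D, Finset.sum_add_distrib, ← Finset.mul_sum]
      ring
    simp only [h2, ← hE] at h1
    have h3 : ∑ v, (E v + t * D v) ^ 2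
        = ∑ v, E v ^ 2 + (2 * t * (∑ v, E v * D v) + t ^ 2 * ∑ v, D v ^ 2) := by
      simp only [Finset.mul_sum, ← Finset.sum_add_distrib]
      exact Finset.sum_congr rfl fun v _ => by ring
    linarith
  have hQ : 0 ≤ ∑ v, D v ^ 2 := Finset.sum_nonneg fun v _ => sq_nonneg _
  have hP : 0 ≤ ∑ v, E v * D v := by
    by_contra hneg
    push Not at hneg
    set P := ∑ v, E v * D v
    set Q := ∑ v, D v ^ 2
    have hpos : 0 < Q - P := by linarith
    have := hvar (-P / (Q - P)) (div_nonneg (by linarith) hpos.le)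
      ((div_le_one hpos).2 (by linarith))
    have h4 : 2 * (-P / (Q - P)) * P + (-P / (Q - P)) ^ 2 * Q
        = (P / (Q - P)) ^ 2 * (2 * P - Q) := by
      field_simp
      ring
    rw [h4] at this
    have h5 : 0 < (P / (Q - P)) ^ 2 := by
      have : P / (Q - P) ≠ 0 := div_ne_zero hneg.ne hpos.ne'
      positivity
    nlinarith
  have hexp : ∑ v, E v * D v = -((∑ u, ∑ v, (f' u v - f u v) * (E u - E v))
      + ∑ v, E v * (h' v - h v)) := by
    have a1 : ∑ v, E v * (∑ u, (f' u v - f u v)) = ∑ u, ∑ v, (f' u v - f u v) * E v := by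
      rw [Finset.sum_comm]
      refine Finset.sum_congr rfl fun v _ => ?_
      rw [Finset.mul_sum]
      exact Finset.sum_congr rfl fun u _ => by ring
    have a2 : ∑ v, E v * (∑ u, (f' v u - f v u)) = ∑ u, ∑ v, (f' u v - f u v) * E u := by
      refine Finset.sum_congr rfl fun v _ => ?_
      rw [Finset.mul_sum]
      exact Finset.sum_congr rfl fun u _ => by ring
    simp only [D, mul_sub (E _) , Finset.sum_sub_distrib] at *
    simp only [mul_sub, Finset.sum_sub_distrib] at *
    linarith
  have hA : ∀ u v, 0 ≤ (f' u v - f u v) * (E u - E v) := by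
    intro u v; simp only [f']; split_ifs
    · exact mul_nonneg (by linarith [hf1 u v]) (by linarith)
    · exact mul_nonneg_of_nonpos_of_nonpos (by linarith [hf0 u v]) (by linarith)
    · simp
  have hB : ∀ v, 0 ≤ E v * (h' v - h v) := by
    intro v; simp only [h']; split_ifs
    · exact mul_nonneg (by linarith) (by linarith [hh1 v])
    · exact mul_nonneg_of_nonpos_of_nonpos (by linarith) (by linarith [hh0 v])
    · simp
  have hAs : 0 ≤ ∑ u, ∑ v, (f' u v - f u v) * (E u - E v) :=
    Finset.sum_nonneg fun u _ => Finset.sum_nonneg fun v _ => hA u v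
  have hBs : 0 ≤ ∑ v, E v * (h' v - h v) := Finset.sum_nonneg fun v _ => hB v
  have hA0 : ∀ u v, (f' u v - f u v) * (E u - E v) = 0 := by
    intro u v
    have q : ∑ u, ∑ v, (f' u v - f u v) * (E u - E v) = 0 := by linarith
    rw [Finset.sum_eq_zero_iff_of_nonneg
      (fun u _ => Finset.sum_nonneg fun v _ => hA u v)] at q
    have q2 := q u (Finset.mem_univ _)
    rw [Finset.sum_eq_zero_iff_of_nonneg (fun v _ => hA u v)] at q2
    exact q2 v (Finset.mem_univ _)
  have hB0 : ∀ v, E v * (h' v - h v) = 0 := by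
    intro v
    have q : ∑ v, E v * (h' v - h v) = 0 := by linarith
    rw [Finset.sum_eq_zero_iff_of_nonneg (fun v _ => hB v)] at q
    exact q v (Finset.mem_univ _)
  have k1 : ∀ u v, E v < E u → f u v = c u v := by
    intro u v huv
    have := hA0 u v
    simp only [f', if_pos huv] at this
    rcases mul_eq_zero.1 this with q | q <;> linarith
  have k2 : ∀ u v, E u < E v → f u v = 0 := by
    intro u v huv
    have := hA0 u v
    simp only [f', if_neg huv.not_gt, if_pos huv] at this
    rcases mul_eq_zero.1 this with q | q <;> linarith
  have k3 : ∀ v, 0 < E v → h v = s v := by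
    intro v hv
    have := hB0 v
    simp only [h', if_pos hv] at this
    rcases mul_eq_zero.1 this with q | q <;> linarith
  have k4 : ∀ v, E v < 0 → h v = 0 := by
    intro v hv
    have := hB0 v
    simp only [h', if_neg hv.not_gt, if_pos hv] at this
    rcases mul_eq_zero.1 this with q | q <;> linarith
  have hsum : ∀ S : Finset V, ∑ v ∈ S, E v = (∑ v ∈ S, ∑ u ∈ Sᶜ, f u v) + (∑ v ∈ S, d v)
      - (∑ v ∈ S, ∑ u ∈ Sᶜ, f v u) - ∑ v ∈ S, h v := by
    intro S
    simp only [hE, e, Finset.sum_sub_distrib, Finset.sum_add_distrib]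
    simp only [← Finset.sum_add_sum_compl S, Finset.sum_add_distrib]
    rw [Finset.sum_comm (s := S) (t := S)]
    ring
  have hpos : ∀ v, E v ≤ 0 := by
    intro v
    by_contra hv
    push Not at hv
    let S := Finset.univ.filter (fun v => 0 < E v)
    have m1 : ∀ v ∈ S, 0 < E v := fun v hv => by simpa [S] using hv
    have m2 : ∀ v ∈ Sᶜ, E v ≤ 0 := fun v hv => by simpa [S] using hv
    have h1 : 0 < ∑ v ∈ S, E v := Finset.sum_pos m1 ⟨v, by simpa [S] using hv⟩
    rw [hsum S] at h1
    have z1 : ∑ v ∈ S, ∑ u ∈ Sᶜ, f u v = 0 :=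
      Finset.sum_eq_zero fun v hv => Finset.sum_eq_zero fun u hu =>
        k2 u v (lt_of_le_of_lt (m2 u hu) (m1 v hv))
    have z2 : ∑ v ∈ S, ∑ u ∈ Sᶜ, f v u = ∑ v ∈ S, ∑ u ∈ Sᶜ, c v u :=
      Finset.sum_congr rfl fun v hv => Finset.sum_congr rfl fun u hu =>
        k1 v u (lt_of_le_of_lt (m2 u hu) (m1 v hv))
    have z3 : ∑ v ∈ S, h v = ∑ v ∈ S, s v :=
      Finset.sum_congr rfl fun v hv => k3 v (m1 v hv)
    have := hcut S
    linarith
  have hneg : ∀ v, 0 ≤ E v := by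
    intro v
    by_contra hv
    push Not at hv
    let S := Finset.univ.filter (fun v => E v < 0)
    have m1 : ∀ v ∈ S, E v < 0 := fun v hv => by simpa [S] using hv
    have m2 : ∀ v ∈ Sᶜ, 0 ≤ E v := fun v hv => by simpa [S] using hv
    have h1 : ∑ v ∈ S, E v < 0 := Finset.sum_neg m1 ⟨v, by simpa [S] using hv⟩
    rw [hsum S] at h1
    have z1 : 0 ≤ ∑ v ∈ S, ∑ u ∈ Sᶜ, f u v :=
      Finset.sum_nonneg fun v hv => Finset.sum_nonneg fun u hu => hf0 u v
    have z2 : ∑ v ∈ S, ∑ u ∈ Sᶜ, f v u = 0 :=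
      Finset.sum_eq_zero fun v hv => Finset.sum_eq_zero fun u hu =>
        k2 v u (lt_of_lt_of_le (m1 v hv) (m2 u hu))
    have z3 : ∑ v ∈ S, h v = 0 :=
      Finset.sum_eq_zero fun v hv => k4 v (m1 v hv)
    have z4 : 0 ≤ ∑ v ∈ S, d v := Finset.sum_nonneg fun v _ => hd v
    linarith
  refine ⟨f, h, fun u v => ⟨hf0 u v, hf1 u v⟩, fun v => ⟨hh0 v, hh1 v⟩, fun v => ?_⟩
  have : E v = 0 := le_antisymm (hpos v) (hneg v)
  simp only [hE, e] at this
  linarith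

lemma sum_filter_ne {V : Type*} [Fintype V] [DecidableEq V] (F : V → ℝ) (S : Finset V) (a : V)
    (ha : a ∈ S) : ∑ u ∈ S.filter (fun u => u ≠ a), F u = (∑ u ∈ S, F u) - F a := by
  rw [Finset.filter_ne', ← Finset.add_sum_erase S F ha]; ring

lemma cut_eq {V : Type*} [Fintype V] [DecidableEq V] (x : Option V → Option V → ℝ)
    (hx : x ∈ Xsub) (S : Finset V) :
    (∑ u ∈ S, ∑ v ∈ Sᶜ, x (some u) (some v)) + ∑ u ∈ S, x (some u) none
      = 2 * ((S.card : ℝ) - inSum x S) := by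
  obtain ⟨hsym, hdiag, -, hdeg, -⟩ := hx
  have h1 : ∀ v : V, (∑ u, x (some v) (some u)) + x (some v) none = 2 := by
    intro v
    have := hdeg v
    rw [degCust, sum_filter_ne _ _ _ (Finset.mem_univ _), hdiag, Fintype.sum_option] at this
    simp only [hsym _ (some v)] at this
    linarith
  have h2 : inSum x S = (1/2) * ∑ u ∈ S, ∑ v ∈ S, x (some u) (some v) := by
    rw [inSum]
    congr 1
    refine Finset.sum_congr rfl fun u hu => ?_
    rw [sum_filter_ne (fun v => x (some u) (some v)) S u hu, hdiag, sub_zero]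
  have h3 : ∑ v ∈ S, ((∑ u, x (some v) (some u)) + x (some v) none) = 2 * S.card := by
    rw [Finset.sum_congr rfl fun v _ => h1 v]; simp [mul_comm]
  simp only [← Finset.sum_add_sum_compl S (fun u => x (some _) (some u)),
    Finset.sum_add_distrib] at h3
  rw [h2]; linarith

/-- Proposition 2 of the paper: for every `x̄ ∈ 𝒳`, the flow variables of
`FLOW(x̄)` can be projected out, yielding the fractional scenario recourse inequalities. -/
theorem statement_6
    (C : ℚ) (hC : 0 < C) (d : Sc → Vp → ℚ)
    (hd : ∀ ξ v, 0 ≤ d ξ v) (hdC : ∀ ξ v, d ξ v ≤ C)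
    (p : Sc → ℚ) (hp : ∀ ξ, 0 ≤ p ξ) (hps : ∑ ξ, p ξ = 1)
    (k : ℕ) (hk : 0 < k)
    (X : Set (Option Vp → Option Vp → ℝ)) (hX : X = Xsub ∨ X = Xcvrp C p d k)
    (b : Vp → ℤ) (hb : ∀ v, 0 ≤ b v)
    (x : Option Vp → Option Vp → ℝ) (hx : x ∈ X) :
    FLOW C d b x =
      {y : Sc → Vp → ℝ | y ∈ Box b ∧ ∀ S : Finset Vp, S.Nonempty → ∀ ξ,
        (((∑ v ∈ S, d ξ v : ℚ) : ℝ) / (C : ℝ) + inSum x S - (S.card : ℝ))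
          ≤ ∑ v ∈ S, y ξ v} := by
  have hx' : x ∈ Xsub := by
    rcases hX with rfl | rfl
    · exact hx
    · exact hx.1
  have hCR : (0 : ℝ) < C := by exact_mod_cast hC
  have hcutx := cut_eq x hx'
  obtain ⟨hsym, hdiag, hbd, hdeg, -⟩ := hx'
  have hx0 : ∀ u v, 0 ≤ x u v := by
    intro u v
    by_cases h : u = v
    · rw [h, hdiag]
    · exact (hbd u v h).1
  have key : ∀ (S : Finset Vp) (ξ : Sc) (y : Sc → Vp → ℝ),
      (((∑ v ∈ S, d ξ v : ℚ) : ℝ) / (C : ℝ) + inSum x S - (S.card : ℝ)) ≤ ∑ v ∈ S, y ξ v ↔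
      ∑ v ∈ S, (d ξ v : ℝ) ≤ (∑ u ∈ S, ∑ v ∈ Sᶜ, (C / 2 : ℝ) * x (some u) (some v))
        + ∑ v ∈ S, ((C / 2 : ℝ) * x (some v) none + C * y ξ v) := by
    intro S ξ y
    have e1 : (∑ u ∈ S, ∑ v ∈ Sᶜ, (C / 2 : ℝ) * x (some u) (some v))
        + ∑ v ∈ S, ((C / 2 : ℝ) * x (some v) none + C * y ξ v)
        = (∑ v ∈ S, y ξ v - inSum x S + S.card) * C := by
      simp only [Finset.sum_add_distrib, ← Finset.mul_sum]
      have := hcutx S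
      linear_combination (C / 2 : ℝ) * this
    rw [e1, ← div_le_iff₀ hCR]
    push_cast
    constructor <;> intro h <;> linarith
  ext y
  simp only [FLOW, Set.mem_setOf_eq]
  refine and_congr_right fun hy => ⟨?_, ?_⟩
  · rintro ⟨f, g, hf, hg, hcons, hcap, hgy⟩ S - ξ
    rw [key]
    have hc : ∀ v, (d ξ v : ℝ) = (∑ u, f ξ (some v) (some u)) - (∑ u, f ξ (some u) (some v))
        + f ξ (some v) none - f ξ none (some v) + g ξ v := by
      intro v
      have := hcons ξ v
      rw [sum_filter_ne _ _ _ (Finset.mem_univ _), sum_filter_ne _ _ _ (Finset.mem_univ _),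
        Fintype.sum_option, Fintype.sum_option] at this
      linarith
    have h1 : ∑ v ∈ S, (d ξ v : ℝ) = (∑ v ∈ S, ∑ u ∈ Sᶜ, f ξ (some v) (some u))
        - (∑ v ∈ S, ∑ u ∈ Sᶜ, f ξ (some u) (some v))
        + ∑ v ∈ S, (f ξ (some v) none - f ξ none (some v) + g ξ v) := by
      rw [Finset.sum_congr rfl fun v _ => hc v]
      simp only [Finset.sum_sub_distrib, Finset.sum_add_distrib]
      simp only [← Finset.sum_add_sum_compl S, Finset.sum_add_distrib]
      rw [Finset.sum_comm (s := S) (t := S)]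
      ring
    have h2 : ∑ v ∈ S, ∑ u ∈ Sᶜ, f ξ (some v) (some u)
        ≤ ∑ u ∈ S, ∑ v ∈ Sᶜ, (C / 2 : ℝ) * x (some u) (some v) := by
      refine Finset.sum_le_sum fun v hv => Finset.sum_le_sum fun u hu => hcap ξ _ _ ?_
      intro h
      rw [Option.some.injEq] at h
      subst h
      exact (Finset.mem_compl.1 hu) hv
    have h3 : 0 ≤ ∑ v ∈ S, ∑ u ∈ Sᶜ, f ξ (some u) (some v) :=
      Finset.sum_nonneg fun _ _ => Finset.sum_nonneg fun _ _ => hf _ _ _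
    have h4 : ∑ v ∈ S, (f ξ (some v) none - f ξ none (some v) + g ξ v)
        ≤ ∑ v ∈ S, ((C / 2 : ℝ) * x (some v) none + C * y ξ v) := by
      refine Finset.sum_le_sum fun v _ => ?_
      linarith [hcap ξ (some v) none (by simp), hf ξ none (some v), hgy ξ v]
    linarith
  · intro H
    have G : ∀ ξ, _ := fun ξ => gale (fun u v => (C / 2 : ℝ) * x (some u) (some v))
      (fun v => (C / 2 : ℝ) * x (some v) none + C * y ξ v) (fun v => (d ξ v : ℝ))
      (fun u v => mul_nonneg (by positivity) (hx0 _ _))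
      (fun v => add_nonneg (mul_nonneg (by positivity) (hx0 _ _))
        (mul_nonneg hCR.le (hy ξ v).1))
      (fun v => by exact_mod_cast hd ξ v)
      (fun S => by
        rcases S.eq_empty_or_nonempty with rfl | hS
        · simp
        · exact (key S ξ y).1 (H S hS ξ))
    choose f h hf hh hcons using G
    refine ⟨fun ξ a c => match a, c with
      | some u, some v => f ξ u v
      | some u, none => min (h ξ u) ((C / 2 : ℝ) * x (some u) none)
      | none, _ => 0,
      fun ξ v => h ξ v - min (h ξ v) ((C / 2 : ℝ) * x (some v) none), ?_, ?_, ?_, ?_, ?_⟩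
    · rintro ξ (_ | u) (_ | v)
      · exact le_rfl
      · exact le_rfl
      · exact le_min (hh ξ u).1 (mul_nonneg (by positivity) (hx0 _ _))
      · exact (hf ξ u v).1
    · intro ξ v
      linarith [min_le_left (h ξ v) ((C / 2 : ℝ) * x (some v) none)]
    · intro ξ v
      rw [sum_filter_ne _ _ _ (Finset.mem_univ _), sum_filter_ne _ _ _ (Finset.mem_univ _),
        Fintype.sum_option, Fintype.sum_option]
      have := hcons ξ v
      dsimp only at this ⊢
      linarith
    · rintro ξ (_ | u) (_ | v) -
      · exact mul_nonneg (by positivity) (hx0 _ _)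
      · exact mul_nonneg (by positivity) (hx0 _ _)
      · exact min_le_right _ _
      · exact (hf ξ u v).2
    · intro ξ v
      have h0 : 0 ≤ C * y ξ v := mul_nonneg hCR.le (hy ξ v).1
      have := (hh ξ v).2
      dsimp only at this ⊢
      rcases min_cases (h ξ v) ((C / 2 : ℝ) * x (some v) none) with q | q <;> linarith

end VRPSD
end
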